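/- For all integers k ≥ 5 and ℓ ≥ 33, the graph G(k,ℓ) does not admit a mixed 1-stack 1-queue layout. -/

import Mathlib

/-- Vertices for the graphs `G(k,ℓ)`: two base vertices and, for each step `k`,
each oriented edge `(u,v)` and each index `i : Fin ℓ`, a potential attached vertex. -/
inductive PV (ℓ : ℕ) : Type where
  | A : PV ℓ
  | B : PV ℓ
  | att : ℕ → PV ℓ → PV ℓ → Fin ℓ → PV ℓ

/-- The (canonically oriented) edges of `G(k,ℓ)`: `G(1,ℓ)` is the single edge `(A,B)`,
and for `k > 1`, `G(k,ℓ)` is obtained from `G(k-1,ℓ)` by attaching `ℓ` new vertices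
to each of its edges. -/
def Gedges (ℓ : ℕ) : ℕ → Set (PV ℓ × PV ℓ)
  | 0 => ∅
  | 1 => {p | p = (PV.A, PV.B)}
  | (k + 2) => Gedges ℓ (k + 1) ∪
      {p | ∃ u v, ∃ i : Fin ℓ, (u, v) ∈ Gedges ℓ (k + 1) ∧
        (p = (PV.att (k + 2) u v i, u) ∨ p = (PV.att (k + 2) u v i, v))}

/-- The graph `G(k,ℓ)`. -/
def Gkl (k ℓ : ℕ) : SimpleGraph (PV ℓ) :=
  SimpleGraph.fromEdgeSet ((fun p => s(p.1, p.2)) '' Gedges ℓ k)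

/-- The graph `Ḡ(k,ℓ)` induced by the edges of `G(k,ℓ)` that are not in `G(k-1,ℓ)`. -/
def Gbar (k ℓ : ℕ) : SimpleGraph (PV ℓ) :=
  SimpleGraph.fromEdgeSet ((fun p => s(p.1, p.2)) '' (Gedges ℓ k \ Gedges ℓ (k - 1)))

/-- A mixed 1-stack 1-queue layout of a graph `G`: a strict total (linear) order `lt`
on the vertices together with an assignment of each edge to the stack (`isStack e`)
or to the queue (`¬ isStack e`), such that no two stack-edges cross and no two
queue-edges nest. -/
structure MixedLayout {V : Type} (G : SimpleGraph V) where
  lt : V → V → Prop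
  isSTO : IsStrictTotalOrder V lt
  isStack : Sym2 V → Prop
  noCross : ∀ a b c d : V, G.Adj a b → G.Adj c d →
    isStack s(a, b) → isStack s(c, d) → ¬(lt a c ∧ lt c b ∧ lt b d)
  noNest : ∀ a b c d : V, G.Adj a b → G.Adj c d →
    ¬isStack s(a, b) → ¬isStack s(c, d) → ¬(lt a c ∧ lt c d ∧ lt d b)

/-- `{a,b}` is an edge of the subgraph `H` that is a stack-edge in the layout `L`. -/
def SEdgeIn {V : Type} {G : SimpleGraph V} (L : MixedLayout G) (H : SimpleGraph V)
    (a b : V) : Prop :=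
  H.Adj a b ∧ L.isStack s(a, b)

/-- `{a,b}` is an edge of the subgraph `H` that is a queue-edge in the layout `L`. -/
def QEdgeIn {V : Type} {G : SimpleGraph V} (L : MixedLayout G) (H : SimpleGraph V)
    (a b : V) : Prop :=
  H.Adj a b ∧ ¬L.isStack s(a, b)

/-- `x` is a stack-attachment of the edge `{u,v}`: both `{x,u}` and `{x,v}` are
stack-edges. -/
def StackAtt {V : Type} {G : SimpleGraph V} (L : MixedLayout G) (x u v : V) : Prop :=
  SEdgeIn L G x u ∧ SEdgeIn L G x v

/-- `x` is a queue-attachment of the edge `{u,v}`: both `{x,u}` and `{x,v}` are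
queue-edges. -/
def QueueAtt {V : Type} {G : SimpleGraph V} (L : MixedLayout G) (x u v : V) : Prop :=
  QEdgeIn L G x u ∧ QEdgeIn L G x v

/-- `x` is a mixed-attachment of the edge `{u,v}`: one of `{x,u}`, `{x,v}` is a
stack-edge and the other is a queue-edge. -/
def MixedAtt {V : Type} {G : SimpleGraph V} (L : MixedLayout G) (x u v : V) : Prop :=
  (SEdgeIn L G x u ∧ QEdgeIn L G x v) ∨ (QEdgeIn L G x u ∧ SEdgeIn L G x v)

/-- `x` is one of the vertices of `Ḡ(k,ℓ)` attached to the edge `{u,v}`, i.e. both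
`{x,u}` and `{x,v}` are edges of `Ḡ(k,ℓ)`. -/
def AttachedAt (ℓ k : ℕ) (x u v : PV ℓ) : Prop :=
  (Gbar k ℓ).Adj x u ∧ (Gbar k ℓ).Adj x v

/-- A smiley face `⟨a,b,u,v,c,d⟩` formed by vertices and edges of the subgraph `H`
in the layout `L`: `a ≺ b ≺ u ≺ v ≺ c ≺ d`, the edges `{a,b}`, `{c,d}`, `{a,d}` of `H`
are queue-edges and the edge `{u,v}` of `H` is a stack-edge. -/
def Smiley {V : Type} {G : SimpleGraph V} (L : MixedLayout G) (H : SimpleGraph V)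
    (a b u v c d : V) : Prop :=
  L.lt a b ∧ L.lt b u ∧ L.lt u v ∧ L.lt v c ∧ L.lt c d ∧
  QEdgeIn L H a b ∧ QEdgeIn L H c d ∧ QEdgeIn L H a d ∧ SEdgeIn L H u v

/-- An abstract mixed layout of a linearly ordered graph in which `E n u v` means that `{u,v}` is
an edge on top of which at least `n` further rounds of attachments have been made. Stack-edges are
given by `S` and queue-edges by `Q`. -/
structure AttachmentLayout (V : Type) [LinearOrder V] where
  E : ℕ → V → V → Prop
  S : V → V → Prop
  Q : V → V → Prop
  E_symm : ∀ {n u v}, E n u v → E n v u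
  S_symm : ∀ {u v}, S u v → S v u
  Q_symm : ∀ {u v}, Q u v → Q v u
  E_ne : ∀ {n u v}, E n u v → u ≠ v
  E_mono : ∀ {n u v}, E (n + 1) u v → E n u v
  S_or_Q : ∀ {n u v}, E n u v → S u v ∨ Q u v
  not_cross : ∀ {a b c d}, S a b → S c d → a < c → c < b → b < d → False
  not_nest : ∀ {a b c d}, Q a b → Q c d → a < c → c < d → d < b → False
  attach : ∀ {n u v}, E (n + 1) u v →
    ∃ x : Fin 33 → V, Function.Injective x ∧ ∀ i, E n (x i) u ∧ E n (x i) v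

namespace AttachmentLayout

open OrderDual

/-- The kinds of attachments of an edge `p < q` that can occur more than once: the vertex lies
between, to the left or to the right of the edge, and its edges to `p` and to `q` are stack-edges
or queue-edges, as indicated by the two final letters. -/
inductive Kind where
  | inQQ | inSQ | inQS | leftSQ | leftQS | rightSQ | rightQS


instance : Fintype Kind where
  elems := ⟨([.inQQ, .inSQ, .inQS, .leftSQ, .leftQS, .rightSQ, .rightQS] : List Kind), by simp⟩
  complete k := by cases k <;> simp

/-- The kind of an attachment in the reversed order. -/
def Kind.rev : Kind → Kind
  | .inQQ => .inQQ
  | .inSQ => .inQS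
  | .inQS => .inSQ
  | .leftSQ => .rightQS
  | .leftQS => .rightSQ
  | .rightSQ => .leftQS
  | .rightQS => .leftSQ

variable {V : Type} [LinearOrder V] (L : AttachmentLayout V)

/-- The vertex `y` is an attachment of the given kind of the edge `p < q`. -/
def Is : Kind → V → V → V → Prop
  | .inQQ, p, q, y => p < y ∧ y < q ∧ L.Q p y ∧ L.Q y q
  | .inSQ, p, q, y => p < y ∧ y < q ∧ L.S p y ∧ L.Q y q
  | .inQS, p, q, y => p < y ∧ y < q ∧ L.Q p y ∧ L.S y q
  | .leftSQ, p, q, y => y < p ∧ L.S y p ∧ L.Q y q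
  | .leftQS, p, q, y => y < p ∧ L.Q y p ∧ L.S y q
  | .rightSQ, p, q, y => q < y ∧ L.S p y ∧ L.Q q y
  | .rightQS, p, q, y => q < y ∧ L.Q p y ∧ L.S q y

/-- Four attachments, in increasing order and of the same kind, of the edge `u < v`. -/
structure Quad (n : ℕ) (k : Kind) (u v : V) (x : Fin 4 → V) : Prop where
  lt : u < v
  mono : StrictMono x
  kind : ∀ i, L.Is k u v (x i)
  edge_left : ∀ i, L.E n u (x i)
  edge_right : ∀ i, L.E n v (x i)

/-- The same layout with the vertex order reversed. -/
def rev : AttachmentLayout Vᵒᵈ where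
  E n u v := L.E n (ofDual u) (ofDual v)
  S u v := L.S (ofDual u) (ofDual v)
  Q u v := L.Q (ofDual u) (ofDual v)
  E_symm := L.E_symm
  S_symm := L.S_symm
  Q_symm := L.Q_symm
  E_ne := L.E_ne
  E_mono := L.E_mono
  S_or_Q := L.S_or_Q
  not_cross h₁ h₂ h₃ h₄ h₅ := L.not_cross (L.S_symm h₂) (L.S_symm h₁) h₅ h₄ h₃
  not_nest h₁ h₂ h₃ h₄ h₅ := L.not_nest (L.Q_symm h₁) (L.Q_symm h₂) h₅ h₄ h₃
  attach := L.attach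

variable {L}

theorem Is.rev {k : Kind} {p q y : V} (h : L.Is k p q y) :
    L.rev.Is k.rev (toDual q) (toDual p) (toDual y) := by
  cases k
  case inQQ | inSQ | inQS =>
    obtain ⟨h₁, h₂, h₃, h₄⟩ := h
    first
    | exact ⟨h₂, h₁, L.Q_symm h₄, L.Q_symm h₃⟩
    | exact ⟨h₂, h₁, L.Q_symm h₄, L.S_symm h₃⟩
    | exact ⟨h₂, h₁, L.S_symm h₄, L.Q_symm h₃⟩
  all_goals
    obtain ⟨h₁, h₂, h₃⟩ := h
    first
    | exact ⟨h₁, L.Q_symm h₃, L.S_symm h₂⟩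
    | exact ⟨h₁, L.S_symm h₃, L.Q_symm h₂⟩

theorem Quad.mono_level {n : ℕ} {k : Kind} {u v : V} {x : Fin 4 → V} (h : L.Quad (n + 1) k u v x) :
    L.Quad n k u v x where
  lt := h.lt
  mono := h.mono
  kind := h.kind
  edge_left i := L.E_mono (h.edge_left i)
  edge_right i := L.E_mono (h.edge_right i)

theorem Quad.rev {n : ℕ} {k : Kind} {u v : V} {x : Fin 4 → V} (h : L.Quad n k u v x) :
    L.rev.Quad n k.rev (toDual v) (toDual u) (fun i => toDual (x i.rev)) where
  lt := h.lt
  mono _ _ hij := h.mono (Fin.rev_lt_rev.2 hij)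
  kind i := (h.kind i.rev).rev
  edge_left i := h.edge_right i.rev
  edge_right i := h.edge_left i.rev

/-- Every edge with enough attachments has four attachments of the same kind that avoid a given
list of at most seven vertices. -/
theorem exists_quad {n : ℕ} {p q : V} (h : L.E (n + 1) p q) (hpq : p < q) (F : List V)
    (hF : F.length ≤ 7) : ∃ k x, L.Quad n k p q x ∧ ∀ i, x i ∉ F := by
  classical
  obtain ⟨x, hx, hxE⟩ := L.attach h
  let A : Finset V := Finset.univ.image x \ F.toFinset
  have hA : 26 ≤ A.card := by
    have h₁ : (Finset.univ.image x).card = 33 := by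
      rw [Finset.card_image_of_injective _ hx, Finset.card_univ, Fintype.card_fin]
    have h₂ : _ ≤ A.card := Finset.le_card_sdiff F.toFinset (Finset.univ.image x)
    have h₃ := F.toFinset_card_le
    omega
  have hAE : ∀ y ∈ A, y ∉ F ∧ L.E n p y ∧ L.E n q y := by
    intro y hy
    simp only [A, Finset.mem_sdiff, Finset.mem_image, Finset.mem_univ, true_and,
      List.mem_toFinset] at hy
    obtain ⟨⟨i, rfl⟩, hy⟩ := hy
    exact ⟨hy, L.E_symm (hxE i).1, L.E_symm (hxE i).2⟩
  let bad : Fin 4 → V → Prop := ![fun y => p < y ∧ y < q ∧ L.S p y ∧ L.S y q,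
    fun y => (y < p ∨ q < y) ∧ L.S p y ∧ L.S y p ∧ L.S q y ∧ L.S y q,
    fun y => y < p ∧ L.Q y p ∧ L.Q y q, fun y => q < y ∧ L.Q p y ∧ L.Q q y]
  have hbad : ∀ i y z, bad i y → bad i z → y < z → False := by
    intro i y z
    fin_cases i <;> simp only [bad, Fin.zero_eta, Fin.mk_one, Fin.reduceFinMk, Matrix.cons_val] <;>
      grind [L.not_cross, L.not_nest]
  have hbad_card : ∀ i, (A.filter (bad i)).card ≤ 1 := by
    intro i
    refine Finset.card_le_one.2 fun y hy z hz => ?_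
    have hy := (Finset.mem_filter.1 hy).2
    have hz := (Finset.mem_filter.1 hz).2
    rcases lt_trichotomy y z with hyz | hyz | hyz
    · exact (hbad i y z hy hz hyz).elim
    · exact hyz
    · exact (hbad i z y hz hy hyz).elim
  have hcover : A ⊆ Finset.univ.biUnion (fun k => A.filter (L.Is k p q)) ∪
      Finset.univ.biUnion (fun i => A.filter (bad i)) := by
    intro y hy
    obtain ⟨-, hp, hq⟩ := hAE y hy
    have hp_ne := L.E_ne hp
    have hq_ne := L.E_ne hq
    have hp' := (L.S_or_Q hp).imp (fun h => And.intro h (L.S_symm h))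
      fun h => And.intro h (L.Q_symm h)
    have hq' := (L.S_or_Q hq).imp (fun h => And.intro h (L.S_symm h))
      fun h => And.intro h (L.Q_symm h)
    simp only [Finset.mem_union, Finset.mem_biUnion, Finset.mem_univ, true_and, Finset.mem_filter,
      hy]
    by_contra! hno
    obtain ⟨h₁, h₂⟩ := hno
    have b₀ := h₂ 0
    have b₁ := h₂ 1
    have b₂ := h₂ 2
    have b₃ := h₂ 3
    have k₁ := h₁ .inQQ
    have k₂ := h₁ .inSQ
    have k₃ := h₁ .inQS
    have k₄ := h₁ .leftSQ
    have k₅ := h₁ .leftQS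
    have k₆ := h₁ .rightSQ
    have k₇ := h₁ .rightQS
    simp only [Is] at k₁ k₂ k₃ k₄ k₅ k₆ k₇
    simp only [bad, Matrix.cons_val] at b₀ b₁ b₂ b₃
    clear h₁ h₂ hbad hbad_card hAE hy hA
    clear_value A bad
    rcases lt_or_gt_of_ne hp_ne with _ | _ <;> rcases lt_or_gt_of_ne hq_ne with _ | _ <;> grind
  obtain ⟨k, hk⟩ : ∃ k, 4 ≤ (A.filter (L.Is k p q)).card := by
    by_contra! hno
    have h₁ : (Finset.univ.biUnion fun k => A.filter (L.Is k p q)).card ≤ 7 * 3 :=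
      Finset.card_biUnion_le_card_mul _ _ _ fun k _ => Nat.le_of_lt_succ (hno k)
    have h₂ : (Finset.univ.biUnion fun i => A.filter (bad i)).card ≤ 4 * 1 :=
      Finset.card_biUnion_le_card_mul _ _ _ fun i _ => hbad_card i
    have h₃ := Finset.card_le_card hcover
    have h₄ := Finset.card_union_le (Finset.univ.biUnion fun k => A.filter (L.Is k p q))
      (Finset.univ.biUnion fun i => A.filter (bad i))
    omega
  let e := (A.filter (L.Is k p q)).orderEmbOfCardLe hk
  have he : ∀ i, e i ∈ A ∧ L.Is k p q (e i) := fun i =>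
    Finset.mem_filter.1 (Finset.orderEmbOfCardLe_mem _ hk i)
  exact ⟨k, e, ⟨hpq, e.strictMono, fun i => (he i).2, fun i => (hAE _ (he i).1).2.1,
    fun i => (hAE _ (he i).1).2.2⟩, fun i => (hAE _ (he i).1).1⟩

theorem exists_attached {n : ℕ} {p q : V} (h : L.E (n + 1) p q) (hpq : p < q) (F : List V)
    (hF : F.length ≤ 7) : ∃ k y, L.Is k p q y ∧ L.E n p y ∧ L.E n q y ∧ y ∉ F := by
  obtain ⟨k, x, hx, hxF⟩ := exists_quad h hpq F hF
  exact ⟨k, x 0, hx.kind 0, hx.edge_left 0, hx.edge_right 0, hxF 0⟩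

/-- No edge with attachments lies strictly below the queue-edge `{a,d}` and strictly between two
queue-edges `{a,b}` and `{c,d}`. -/
theorem not_edge_between {a b u v c d : V} (hab : a < b) (hbu : b < u) (huv : u < v) (hvc : v < c)
    (hcd : c < d) (qab : L.Q a b) (qcd : L.Q c d) (qad : L.Q a d) (h : L.E 1 u v) : False := by
  obtain ⟨k, y, hy, -, -, hyF⟩ := exists_attached h huv [a, b, c, d] (by simp)
  simp only [List.mem_cons, List.not_mem_nil, or_false, not_or] at hyF
  cases k <;> simp only [Is] at hy <;> grind [L.not_nest]

/-! ### Attachments of attachment edges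

Let `x 0 < x 1 < x 2 < x 3` be attachments of the same kind of the edge `u < v`. The following
lemmas restrict the kinds of the attachments of `{u, x 1}` (suffix `lo`) or `{x 1, v}` (suffix
`hi`); a further kind in the name stands for an attachment `y` of that edge, and then the lemma
restricts the attachments of `{x 1, y}`. -/

theorem Quad.spec {n : ℕ} {k : Kind} {u v : V} {x : Fin 4 → V} (h : L.Quad n k u v x) :
    u < v ∧ x 0 < x 1 ∧ x 1 < x 2 ∧ L.Is k u v (x 0) ∧ L.Is k u v (x 1) ∧ L.Is k u v (x 2) :=
  ⟨h.lt, h.mono (by decide), h.mono (by decide), h.kind 0, h.kind 1, h.kind 2⟩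

theorem Quad.leftQS_lo {n : ℕ} {k : Kind} {u v y : V} {x : Fin 4 → V}
    (h : L.Quad n .leftQS u v x) (ny : y ∉ [v, x 0, x 2]) (ky : L.Is k (x 1) u y) :
    k = .inSQ ∨ k = .leftSQ := by
  have hx := h.spec
  simp only [List.mem_cons, List.not_mem_nil, or_false, not_or] at ny
  cases k <;> simp only [Is, reduceCtorEq, or_false, or_true] at * <;>
    grind [L.not_cross, L.not_nest]

theorem Quad.leftQS_inSQ {n : ℕ} {k : Kind} {u v y z : V} {x : Fin 4 → V}
    (h : L.Quad n .leftQS u v x) (ky : L.Is .inSQ (x 1) u y) (nz : z ∉ [u, v, x 0, x 2])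
    (kz : L.Is k (x 1) y z) : False := by
  have hx := h.spec
  simp only [List.mem_cons, List.not_mem_nil, or_false, not_or] at nz
  cases k <;> simp only [Is] at * <;>
    grind [L.not_cross, L.not_nest]

theorem Quad.leftQS_leftSQ {n : ℕ} {k : Kind} {u v y z : V} {x : Fin 4 → V}
    (h : L.Quad n .leftQS u v x) (ky : L.Is .leftSQ (x 1) u y) (ny : y ∉ [v, x 0, x 2])
    (nz : z ∉ [u, v, x 0, x 2]) (kz : L.Is k y (x 1) z) : False := by
  have hx := h.spec
  simp only [List.mem_cons, List.not_mem_nil, or_false, not_or] at ny nz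
  rcases lt_or_gt_of_ne ny.2.1 with _ | _ <;>
  cases k <;> simp only [Is] at * <;>
    grind [L.not_cross, L.not_nest]

theorem Quad.leftSQ_lo {n : ℕ} {k : Kind} {u v y : V} {x : Fin 4 → V}
    (h : L.Quad n .leftSQ u v x) (ny : y ∉ [v, x 0, x 2]) (ky : L.Is k (x 1) u y) :
    k = .leftQS := by
  have hx := h.spec
  simp only [List.mem_cons, List.not_mem_nil, or_false, not_or] at ny
  cases k <;> simp only [Is, reduceCtorEq] at * <;>
    grind [L.not_cross, L.not_nest]

theorem Quad.inSQ_hi {n : ℕ} {k : Kind} {u v y : V} {x : Fin 4 → V}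
    (h : L.Quad n .inSQ u v x) (ky : L.Is k (x 1) v y) : k = .inSQ ∨ k = .leftSQ ∨ k = .leftQS := by
  have hx := h.spec
  cases k <;> simp only [Is, reduceCtorEq, or_false, or_true] at * <;>
    grind [L.not_cross, L.not_nest]

theorem Quad.inSQ_inSQ {n : ℕ} {k : Kind} {u v y z : V} {x : Fin 4 → V}
    (h : L.Quad n .inSQ u v x) (ky : L.Is .inSQ (x 1) v y) (ny : y ∉ [u, x 0, x 2])
    (nz : z ∉ [u, v, x 0, x 2]) (kz : L.Is k (x 1) y z) : False := by
  have hx := h.spec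
  simp only [List.mem_cons, List.not_mem_nil, or_false, not_or] at ny nz
  rcases lt_or_gt_of_ne ny.2.1 with _ | _ <;>
  rcases lt_or_gt_of_ne ny.2.2 with _ | _ <;>
  rcases lt_or_gt_of_ne nz.2.2.1 with _ | _ <;>
  rcases lt_or_gt_of_ne nz.2.2.2 with _ | _ <;>
  cases k <;> simp only [Is] at * <;>
    grind [L.not_cross, L.not_nest]

theorem Quad.inSQ_leftSQ {n : ℕ} {k : Kind} {u v y z : V} {x : Fin 4 → V}
    (h : L.Quad n .inSQ u v x) (ky : L.Is .leftSQ (x 1) v y) (ny : y ∉ [u, x 0, x 2])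
    (nz : z ∉ [u, v, x 0, x 2]) (kz : L.Is k y (x 1) z) : False := by
  have hx := h.spec
  simp only [List.mem_cons, List.not_mem_nil, or_false, not_or] at ny nz
  rcases lt_or_gt_of_ne ny.2.1 with _ | _ <;>
  rcases lt_or_gt_of_ne nz.2.2.1 with _ | _ <;>
  cases k <;> simp only [Is] at * <;>
    grind [L.not_cross, L.not_nest]

theorem Quad.inQQ_lo_of_stack {n : ℕ} {k : Kind} {u v y : V} {x : Fin 4 → V}
    (h : L.Quad n .inQQ u v x) (c : L.S u v) (ny : y ∉ [v, x 0, x 2]) (ky : L.Is k u (x 1) y) :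
    k = .inQS ∨ k = .rightQS := by
  have hx := h.spec
  simp only [List.mem_cons, List.not_mem_nil, or_false, not_or] at ny
  cases k <;> simp only [Is, reduceCtorEq, or_false, or_true] at * <;>
    grind [L.not_cross, L.not_nest]

theorem Quad.inQQ_lo {n : ℕ} {k : Kind} {u v y : V} {x : Fin 4 → V}
    (h : L.Quad n .inQQ u v x) (ny : y ∉ [v, x 0, x 2]) (ky : L.Is k u (x 1) y) :
    k = .inQS ∨ k = .leftQS ∨ k = .rightQS := by
  have hx := h.spec
  simp only [List.mem_cons, List.not_mem_nil, or_false, not_or] at ny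
  cases k <;> simp only [Is, reduceCtorEq, or_false, or_true] at * <;>
    grind [L.not_cross, L.not_nest]

theorem Quad.inQQ_rightQS {n : ℕ} {k : Kind} {u v z : V} {x : Fin 4 → V}
    (h : L.Quad n .inQQ u v x) (c : L.S u v) {m : ℕ} {y : Fin 4 → V}
    (hy : L.Quad m .rightQS u (x 1) y) (ny : ∀ i, y i ∉ [v, x 0, x 2]) (nz : z ∉ [u, v, x 0, y 1])
    (kz : L.Is k (x 1) (y 0) z) : False := by
  have hx := h.spec
  have hy := hy.spec
  have ny₀ := ny 0
  have ny₁ := ny 1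
  clear ny
  simp only [List.mem_cons, List.not_mem_nil, or_false, not_or] at ny₀ ny₁ nz
  cases k <;> simp only [Is] at * <;>
    grind [L.not_cross, L.not_nest]

theorem Quad.inQQ_inQS {n : ℕ} {k : Kind} {u v y z : V} {x : Fin 4 → V}
    (h : L.Quad n .inQQ u v x) (c : L.S u v) (ky : L.Is .inQS u (x 1) y) (nz : z ∉ [u, v, x 0, x 2])
    (kz : L.Is k y (x 1) z) : k = .rightQS := by
  have hx := h.spec
  simp only [List.mem_cons, List.not_mem_nil, or_false, not_or] at nz
  cases k <;> simp only [Is, reduceCtorEq] at * <;>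
    grind [L.not_cross, L.not_nest]

theorem Quad.inQQ_inQS_rightQS {n : ℕ} {k : Kind} {u v w y : V} {x : Fin 4 → V}
    (h : L.Quad n .inQQ u v x) (c : L.S u v) (ky : L.Is .inQS u (x 1) y) {m : ℕ} {z : Fin 4 → V}
    (hz : L.Quad m .rightQS y (x 1) z) (nz : ∀ i, z i ∉ [u, v, x 0, x 2])
    (nw : w ∉ [u, v, x 0, x 2, y, z 0, z 2]) (kw : L.Is k (x 1) (z 1) w) : False := by
  have hx := h.spec
  have hz := hz.spec
  have nz₀ := nz 0
  have nz₁ := nz 1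
  have nz₂ := nz 2
  clear nz
  simp only [List.mem_cons, List.not_mem_nil, or_false, not_or] at nz₀ nz₁ nz₂ nw
  cases k <;> simp only [Is] at * <;>
    grind [L.not_cross, L.not_nest]

/-- No edge has four attachments to its left with queue-edges to its lower and stack-edges to its
upper end-vertex. -/
theorem Quad.leftQS_false {u v : V} {x : Fin 4 → V} (h : L.Quad 2 .leftQS u v x) : False := by
  obtain ⟨k, y, ky, ey, -, ny⟩ :=
    exists_attached (L.E_symm (h.edge_left 1)) (h.kind 1).1 [v, x 0, x 2] (by simp)
  obtain rfl | rfl := h.leftQS_lo ny ky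
  · obtain ⟨k, z, kz, -, -, nz⟩ := exists_attached ey ky.1 [u, v, x 0, x 2] (by simp)
    exact h.leftQS_inSQ ky nz kz
  · obtain ⟨k, z, kz, -, -, nz⟩ := exists_attached (L.E_symm ey) ky.1 [u, v, x 0, x 2] (by simp)
    exact h.leftQS_leftSQ ky ny nz kz

/-- No edge has four attachments to its left with stack-edges to its lower and queue-edges to its
upper end-vertex. -/
theorem Quad.leftSQ_false {u v : V} {x : Fin 4 → V} (h : L.Quad 3 .leftSQ u v x) : False := by
  obtain ⟨k, y, hy, ny⟩ :=
    exists_quad (L.E_symm (h.edge_left 1)) (h.kind 1).1 [v, x 0, x 2] (by simp)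
  obtain rfl := h.leftSQ_lo (ny 0) (hy.kind 0)
  exact hy.leftQS_false

/-- No edge has four attachments between its end-vertices with stack-edges to its lower and
queue-edges to its upper end-vertex. -/
theorem Quad.inSQ_false {u v : V} {x : Fin 4 → V} (h : L.Quad 3 .inSQ u v x) : False := by
  obtain ⟨k, y, hy, ny⟩ :=
    exists_quad (L.E_symm (h.edge_right 1)) (h.kind 1).2.1 [u, x 0, x 2] (by simp)
  obtain rfl | rfl | rfl := h.inSQ_hi (hy.kind 0)
  · obtain ⟨k, z, kz, -, -, nz⟩ :=
      exists_attached (hy.edge_left 0) (hy.kind 0).1 [u, v, x 0, x 2] (by simp)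
    exact h.inSQ_inSQ (hy.kind 0) (ny 0) nz kz
  · obtain ⟨k, z, kz, -, -, nz⟩ :=
      exists_attached (L.E_symm (hy.edge_left 0)) (hy.kind 0).1 [u, v, x 0, x 2] (by simp)
    exact h.inSQ_leftSQ (hy.kind 0) (ny 0) nz kz
  · exact hy.leftQS_false

/-- No stack-edge has four queue-attachments between its end-vertices. -/
theorem Quad.inQQ_not_stack {u v : V} {x : Fin 4 → V} (h : L.Quad 3 .inQQ u v x)
    (c : L.S u v) : False := by
  obtain ⟨k, y, hy, ny⟩ := exists_quad (h.edge_left 1) (h.kind 1).1 [v, x 0, x 2] (by simp)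
  obtain rfl | rfl := h.inQQ_lo_of_stack c (ny 0) (hy.kind 0)
  · obtain ⟨k, z, hz, nz⟩ := exists_quad (L.E_symm (hy.edge_right 0)) (hy.kind 0).2.1
      [u, v, x 0, x 2] (by simp)
    obtain rfl := h.inQQ_inQS c (hy.kind 0) (nz 0) (hz.kind 0)
    obtain ⟨k, w, kw, -, -, nw⟩ := exists_attached (hz.edge_right 1) (hz.kind 1).1
      [u, v, x 0, x 2, y 0, z 0, z 2] (by simp)
    exact h.inQQ_inQS_rightQS c (hy.kind 0) hz nz nw kw
  · obtain ⟨k, z, kz, -, -, nz⟩ := exists_attached (hy.edge_right 0) (hy.kind 0).1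
      [u, v, x 0, y 1] (by simp)
    exact h.inQQ_rightQS c hy ny nz kz

/-- An attachment of `{u, x 1}` lies to the right of `x 2` and is joined to `x 1` in the stack. -/
theorem Quad.exists_stack_of_inQQ {u v : V} {x : Fin 4 → V} (h : L.Quad 3 .inQQ u v x)
    (c : L.Q u v) : ∃ y, x 2 < y ∧ L.S (x 1) y := by
  have h01 : x 0 < x 1 := h.mono (by decide)
  have h12 : x 1 < x 2 := h.mono (by decide)
  obtain ⟨k, y, hy, ny⟩ := exists_quad (h.edge_left 1) (h.kind 1).1 [v, x 0, x 2] (by simp)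
  obtain ⟨hx0, -, hx0', -⟩ := h.kind 0
  obtain ⟨-, hx2, -, hx2'⟩ := h.kind 2
  obtain rfl | rfl | rfl := h.inQQ_lo (ny 0) (hy.kind 0)
  · exact (not_edge_between (hy.kind 0).1 (hy.mono (by decide : (0 : Fin 4) < 1))
      (hy.kind 1).2.1 h12 hx2 (hy.kind 0).2.2.1 hx2' c
      (L.E_mono (L.E_symm (hy.edge_right 1)))).elim
  · exact hy.leftQS_false.elim
  · refine ⟨y 0, ?_, (hy.kind 0).2.2⟩
    by_contra! hlt
    have hne : y 0 ≠ x 2 := fun he => ny 0 (by simp [he])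
    exact not_edge_between hx0 h01 (hy.kind 0).1 (lt_of_le_of_ne hlt hne) hx2 hx0' hx2' c
      (L.E_mono (hy.edge_right 0))

/-- No edge has four queue-attachments between its end-vertices. -/
theorem Quad.inQQ_false {u v : V} {x : Fin 4 → V} (h : L.Quad 3 .inQQ u v x)
    (c : L.S u v ∨ L.Q u v) : False := by
  obtain c | c := c
  · exact h.inQQ_not_stack c
  · obtain ⟨y, hy, sy⟩ := h.exists_stack_of_inQQ c
    obtain ⟨z, hz, sz⟩ := h.rev.exists_stack_of_inQQ (L.Q_symm c)
    exact L.not_cross (L.S_symm sz) sy hz (h.mono (by decide : (1 : Fin 4) < 2)) hy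

theorem not_E_four (L : AttachmentLayout V) {u v : V} : ¬ L.E 4 u v := by
  intro h
  wlog huv : u < v generalizing u v
  · exact this (L.E_symm h) (lt_of_le_of_ne (not_lt.1 huv) (L.E_ne h).symm)
  obtain ⟨k, x, hx, -⟩ := exists_quad h huv [] (by simp)
  have hx' := hx.rev
  cases k
  · exact hx.inQQ_false (L.S_or_Q h)
  · exact hx.inSQ_false
  · exact hx'.inSQ_false
  · exact hx.leftSQ_false
  · exact hx.mono_level.leftQS_false
  · exact hx'.mono_level.leftQS_false
  · exact hx'.leftSQ_false

end AttachmentLayout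

theorem Gedges_mono (ℓ : ℕ) : Monotone (Gedges ℓ) := by
  refine monotone_nat_of_le_succ fun n => ?_
  cases n with
  | zero => exact Set.empty_subset _
  | succ n => exact Set.subset_union_left

theorem PV.att_ne_left {ℓ n : ℕ} {u v : PV ℓ} {i : Fin ℓ} : PV.att n u v i ≠ u := by
  intro h
  have h := congrArg sizeOf h
  simp only [PV.att.sizeOf_spec] at h
  omega

theorem PV.att_ne_right {ℓ n : ℕ} {u v : PV ℓ} {i : Fin ℓ} : PV.att n u v i ≠ v := by
  intro h
  have h := congrArg sizeOf h
  simp only [PV.att.sizeOf_spec] at h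
  omega

theorem ne_of_mem_Gedges {ℓ : ℕ} : ∀ {n : ℕ} {u v : PV ℓ}, (u, v) ∈ Gedges ℓ n → u ≠ v
  | 0, _, _, h => h.elim
  | 1, _, _, h => by
    obtain ⟨rfl, rfl⟩ := Prod.mk.inj h
    exact nofun
  | n + 2, _, _, h => by
    obtain h | ⟨u, v, i, -, h | h⟩ := h
    · exact ne_of_mem_Gedges h
    · obtain ⟨rfl, rfl⟩ := Prod.mk.inj h
      exact PV.att_ne_left
    · obtain ⟨rfl, rfl⟩ := Prod.mk.inj h
      exact PV.att_ne_right

theorem exists_attached_of_mem_Gedges {ℓ n : ℕ} (hl : 33 ≤ ℓ) {u v : PV ℓ}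
    (h : (u, v) ∈ Gedges ℓ n) : ∃ x : Fin 33 → PV ℓ, Function.Injective x ∧
      ∀ i, (x i, u) ∈ Gedges ℓ (n + 1) ∧ (x i, v) ∈ Gedges ℓ (n + 1) := by
  cases n with
  | zero => exact h.elim
  | succ n =>
    refine ⟨fun i => PV.att (n + 2) u v (Fin.castLE hl i), fun i j hij => ?_, fun i =>
      ⟨Or.inr ⟨u, v, _, h, Or.inl rfl⟩, Or.inr ⟨u, v, _, h, Or.inr rfl⟩⟩⟩
    exact Fin.castLE_injective hl (PV.att.inj hij).2.2.2

theorem adj_of_mem_Gedges {k ℓ : ℕ} {u v : PV ℓ} (h : (u, v) ∈ Gedges ℓ k) :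
    (Gkl k ℓ).Adj u v :=
  (SimpleGraph.fromEdgeSet_adj _).2 ⟨⟨_, h, rfl⟩, ne_of_mem_Gedges h⟩

/-- The linear order of the vertices in a mixed layout. -/
@[reducible]
noncomputable def MixedLayout.linearOrder {V : Type} {G : SimpleGraph V} (L : MixedLayout G) :
    LinearOrder V :=
  letI := L.isSTO
  letI := Classical.decRel L.lt
  linearOrderOfSTO L.lt

/-- A mixed layout of `G(k,ℓ)` as an abstract layout: in an edge of `G(j,ℓ)` at least `k - j`
rounds of attachments are made. -/
def MixedLayout.toAttachmentLayout {k ℓ : ℕ} (hl : 33 ≤ ℓ) (L : MixedLayout (Gkl k ℓ)) :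
    @AttachmentLayout (PV ℓ) L.linearOrder :=
  letI := L.linearOrder
  { E := fun n u v => ∃ j, j + n ≤ k ∧ ((u, v) ∈ Gedges ℓ j ∨ (v, u) ∈ Gedges ℓ j)
    S := SEdgeIn L (Gkl k ℓ)
    Q := QEdgeIn L (Gkl k ℓ)
    E_symm := fun ⟨j, hj, h⟩ => ⟨j, hj, h.symm⟩
    S_symm := fun ⟨h, hs⟩ => ⟨h.symm, Sym2.eq_swap ▸ hs⟩
    Q_symm := fun ⟨h, hs⟩ => ⟨h.symm, Sym2.eq_swap ▸ hs⟩
    E_ne := fun ⟨_, _, h⟩ => h.elim ne_of_mem_Gedges fun h => (ne_of_mem_Gedges h).symm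
    E_mono := fun ⟨j, hj, h⟩ => ⟨j, by omega, h⟩
    S_or_Q := by
      rintro n u v ⟨j, hj, h⟩
      have hadj : (Gkl k ℓ).Adj u v := by
        have hjk := Gedges_mono ℓ (show j ≤ k by omega)
        exact h.elim (fun h => adj_of_mem_Gedges (hjk h))
          fun h => (adj_of_mem_Gedges (hjk h)).symm
      exact (em (L.isStack s(u, v))).imp (And.intro hadj) (And.intro hadj)
    not_cross := fun h₁ h₂ h₃ h₄ h₅ => L.noCross _ _ _ _ h₁.1 h₂.1 h₁.2 h₂.2 ⟨h₃, h₄, h₅⟩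
    not_nest := fun h₁ h₂ h₃ h₄ h₅ => L.noNest _ _ _ _ h₁.1 h₂.1 h₁.2 h₂.2 ⟨h₃, h₄, h₅⟩
    attach := by
      rintro n u v ⟨j, hj, h | h⟩ <;> obtain ⟨x, hx, hxE⟩ := exists_attached_of_mem_Gedges hl h
      · exact ⟨x, hx, fun i => ⟨⟨j + 1, by omega, Or.inl (hxE i).1⟩,
          ⟨j + 1, by omega, Or.inl (hxE i).2⟩⟩⟩
      · exact ⟨x, hx, fun i => ⟨⟨j + 1, by omega, Or.inl (hxE i).2⟩,
          ⟨j + 1, by omega, Or.inl (hxE i).1⟩⟩⟩ }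

/-- For all integers `k ≥ 5` and `ℓ ≥ 33`, the graph `G(k,ℓ)` does not admit a
mixed 1-stack 1-queue layout. -/
theorem no_mixed_layout (k ℓ : ℕ) (hk : 5 ≤ k) (hl : 33 ≤ ℓ) :
    IsEmpty (MixedLayout (Gkl k ℓ)) := by
  refine ⟨fun L => ?_⟩
  let := L.linearOrder
  exact (L.toAttachmentLayout hl).not_E_four (u := PV.A) (v := PV.B) ⟨1, by omega, Or.inl rfl⟩
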